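/- arXiv:2409.07742 — 8 statements merged into one kernel-verified Lean document; each statement's English description precedes it below -/
import Mathlib

section
/- For every real number λ, every positive integer k and every positive integer n, the sum S_{k,λ}(n) = Σ_{j=1}^{n} (j)_{k,λ} satisfies the recurrence S_{k,λ}(n) = ((n+1)_{k+1,λ} − (1)_{k+1,λ})/(k+1) − (1/(k+1)) · Σ_{r=0}^{k−1} C(k+1, r) · (1)_{k+1−r,λ} · S_{r,λ}(n). -/
/-- The degenerate falling factorial `(x)_{n,λ} = x(x-λ)(x-2λ)⋯(x-(n-1)λ)`. -/
def dfact (lam x : ℝ) (n : ℕ) : ℝ := ∏ i ∈ Finset.range n, (x - i * lam)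

/-- The degenerate rising factorial `⟨x⟩_{n,λ} = x(x+λ)(x+2λ)⋯(x+(n-1)λ)`. -/
def drise (lam x : ℝ) (n : ℕ) : ℝ := ∏ i ∈ Finset.range n, (x + i * lam)

/-- `S_{k,λ}(n) = Σ_{j=1}^n (j)_{k,λ}`. -/
def Sdeg (lam : ℝ) (k n : ℕ) : ℝ := ∑ j ∈ Finset.Icc 1 n, dfact lam j k

theorem dfact_zero (lam x : ℝ) : dfact lam x 0 = 1 := by
  simp [dfact]

theorem dfact_succ (lam x : ℝ) (n : ℕ) :
    dfact lam x (n + 1) = dfact lam x n * (x - n * lam) :=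
  Finset.prod_range_succ _ _

/-- The Chu–Vandermonde identity for degenerate falling factorials. -/
theorem dfact_add (lam x y : ℝ) (n : ℕ) :
    dfact lam (x + y) n = ∑ p ∈ Finset.HasAntidiagonal.antidiagonal n,
      (n.choose p.1 : ℝ) * (dfact lam x p.1 * dfact lam y p.2) := by
  induction n with
  | zero => simp [dfact_zero]
  | succ n ih =>
    rw [Finset.sum_antidiagonal_choose_succ_mul (fun i j => dfact lam x i * dfact lam y j),
      dfact_succ, ih, Finset.sum_mul, ← Finset.sum_add_distrib]
    refine Finset.sum_congr rfl fun p hp => ?_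
    obtain rfl := Finset.HasAntidiagonal.mem_antidiagonal.mp hp
    rw [← Nat.choose_symm_add, dfact_succ, dfact_succ]
    push_cast
    ring

theorem dfact_add_one_sub (lam x : ℝ) (k : ℕ) :
    dfact lam (x + 1) (k + 1) - dfact lam x (k + 1) =
      (∑ r ∈ Finset.range k,
        ((k + 1).choose r : ℝ) * dfact lam 1 (k + 1 - r) * dfact lam x r) +
      (k + 1) * dfact lam x k := by
  rw [dfact_add, Finset.Nat.sum_antidiagonal_eq_sum_range_succ
    (fun i j => ((k + 1).choose i : ℝ) * (dfact lam x i * dfact lam 1 j)),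
    Finset.sum_range_succ, Finset.sum_range_succ]
  have h : dfact lam 1 1 = 1 := by simp [dfact]
  simp only [Nat.choose_self, Nat.choose_succ_self_right, Nat.sub_self, Nat.add_sub_cancel_left,
    dfact_zero, h, Nat.cast_one, Nat.cast_add, one_mul, mul_one, add_sub_cancel_right]
  congr 1
  exact Finset.sum_congr rfl fun r _ => by ring

theorem sum_dfact_add_one_sub (lam : ℝ) (m n : ℕ) :
    ∑ j ∈ Finset.Icc 1 n, (dfact lam (j + 1) m - dfact lam j m) =
      dfact lam (n + 1) m - dfact lam 1 m := by
  induction n with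
  | zero => simp
  | succ n ih =>
    rw [Finset.sum_Icc_succ_top (Nat.le_add_left 1 n), ih]
    push_cast
    ring

theorem stmt_0 (lam : ℝ) (k n : ℕ) (hk : 0 < k) (hn : 0 < n) :
    Sdeg lam k n =
      (dfact lam (n + 1) (k + 1) - dfact lam 1 (k + 1)) / (k + 1) -
        (1 / (k + 1)) * ∑ r ∈ Finset.range k,
          ((k + 1).choose r : ℝ) * dfact lam 1 (k + 1 - r) * Sdeg lam r n := by
  have h := sum_dfact_add_one_sub lam (k + 1) n
  simp only [dfact_add_one_sub, Finset.sum_add_distrib, ← Finset.mul_sum] at h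
  rw [Finset.sum_comm] at h
  simp only [← Finset.mul_sum] at h
  have hk' : (k + 1 : ℝ) ≠ 0 := by positivity
  rw [← h]
  simp only [Sdeg]
  field_simp
  ring
end

section
/- For every real number λ, every positive integer k and every positive integer n, the sum S_{k,λ}(n) = Σ_{j=1}^{n} (j)_{k,λ} satisfies the recurrence S_{k,λ}(n) = (n)_{k+1,λ}/(k+1) + (1/(k+1)) · Σ_{r=0}^{k−1} C(k+1, r) · (−1)^{k+1−r} · ⟨1⟩_{k+1−r,λ} · S_{r,λ}(n). -/
theorem dfact_neg (lam x : ℝ) (n : ℕ) :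
    dfact lam (-x) n = (-1) ^ n * drise lam x n := by
  rw [dfact, drise, ← Finset.card_range n, ← Finset.prod_const, Finset.card_range,
    ← Finset.prod_mul_distrib]
  exact Finset.prod_congr rfl fun i _ => by ring

theorem dfact_sub_one (lam x : ℝ) (n : ℕ) :
    dfact lam (x - 1) n =
      ∑ r ∈ Finset.range (n + 1),
        (n.choose r : ℝ) * (-1) ^ (n - r) * drise lam 1 (n - r) * dfact lam x r := by
  rw [sub_eq_add_neg, dfact_add, Finset.Nat.sum_antidiagonal_eq_sum_range_succ_mk]
  refine Finset.sum_congr rfl fun r _ => ?_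
  rw [dfact_neg]
  ring

theorem sum_dfact_sub (lam : ℝ) (k n : ℕ) :
    ∑ j ∈ Finset.Icc 1 n, (dfact lam (j - 1) (k + 1) - dfact lam j (k + 1)) =
      -dfact lam n (k + 1) := by
  induction n with
  | zero => simp [dfact, Finset.prod_range_succ']
  | succ n ih =>
    rw [Finset.sum_Icc_succ_top (by omega), ih]
    push_cast
    rw [add_sub_cancel_right]
    ring

theorem stmt_1 (lam : ℝ) (k n : ℕ) (hk : 0 < k) (hn : 0 < n) :
    Sdeg lam k n =
      dfact lam n (k + 1) / (k + 1) +
        (1 / (k + 1)) * ∑ r ∈ Finset.range k,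
          ((k + 1).choose r : ℝ) * (-1) ^ (k + 1 - r) * drise lam 1 (k + 1 - r) *
            Sdeg lam r n := by
  have hstep (j : ℕ) : dfact lam (j - 1) (k + 1) - dfact lam j (k + 1) =
      ∑ r ∈ Finset.range k, ((k + 1).choose r : ℝ) * (-1) ^ (k + 1 - r) *
        drise lam 1 (k + 1 - r) * dfact lam j r - (k + 1) * dfact lam j k := by
    rw [dfact_sub_one, Finset.sum_range_succ, Finset.sum_range_succ]
    simp [drise]
    ring
  have hsum := sum_dfact_sub lam k n
  simp_rw [hstep, Finset.sum_sub_distrib] at hsum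
  rw [Finset.sum_comm] at hsum
  simp_rw [← Finset.mul_sum] at hsum
  unfold Sdeg
  field_simp
  linarith
end

section
/- Let λ be a real number, let k be a positive integer, and let X be a nonnegative integer-valued random variable (given by a probability mass function p : ℕ → ℝ≥0 with Σ_{x=0}^{∞} p(x) = 1) such that Σ_{x=0}^{∞} |(x)_{k,λ}| · p(x) < ∞. Then the k-th degenerate moment of X satisfies E[(X)_{k,λ}] = Σ_{x=0}^{∞} (x)_{k,λ} · p(x) = Σ_{x=0}^{∞} ((x+1)_{k,λ} − (x)_{k,λ}) · P{X > x}, where P{X > x} = Σ_{y=x+1}^{∞} p(y). -/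
open Filter Topology in
/-- Summation by parts against the tails of a nonnegative summable sequence. -/
theorem hasSum_sub_mul_tsum_tail {f q : ℕ → ℝ} {M : ℕ} (hf0 : f 0 = 0)
    (hpos : ∀ n, M ≤ n → 0 ≤ f n) (hmono : ∀ m n, M ≤ m → m ≤ n → f m ≤ f n)
    (hq0 : ∀ n, 0 ≤ q n) (hq : Summable q) (hfq : Summable fun n => f n * q n) :
    HasSum (fun n => (f (n + 1) - f n) * ∑' y, q (n + 1 + y)) (∑' n, f n * q n) := by
  have htail (n : ℕ) : Summable fun y => q (n + y) := by
    simpa only [add_comm n] using (summable_nat_add_iff n).2 hq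
  have hstep (n : ℕ) : ∑' y, q (n + y) = q n + ∑' y, q (n + 1 + y) := by
    rw [(htail n).tsum_eq_zero_add]
    simp only [add_zero, add_assoc, add_comm 1]
  have hparts (N : ℕ) : ∑ n ∈ Finset.range N, (f (n + 1) - f n) * ∑' y, q (n + 1 + y) =
      ∑ n ∈ Finset.range N, f n * q n + f N * ∑' y, q (N + y) := by
    induction N with
    | zero => simp [hf0]
    | succ N ih =>
      rw [Finset.sum_range_succ, Finset.sum_range_succ, ih, hstep N]
      ring
  have hboundary : Tendsto (fun N => f N * ∑' y, q (N + y)) atTop (𝓝 0) := by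
    refine squeeze_zero' ?_ ?_ (tendsto_sum_nat_add fun n => f n * q n)
    · filter_upwards [eventually_ge_atTop M] with N hN
      exact mul_nonneg (hpos N hN) (tsum_nonneg fun y => hq0 _)
    · filter_upwards [eventually_ge_atTop M] with N hN
      rw [← tsum_mul_left]
      refine ((htail N).mul_left _).tsum_le_tsum (fun y => ?_) ((summable_nat_add_iff N).2 hfq)
      rw [add_comm N y]
      exact mul_le_mul_of_nonneg_right (hmono N _ hN (by omega)) (hq0 _)
  have hlim : Tendsto
      (fun N => ∑ n ∈ Finset.range N, (f (n + 1) - f n) * ∑' y, q (n + 1 + y)) atTop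
      (𝓝 (∑' n, f n * q n)) := by
    simp only [hparts]
    simpa using hfq.hasSum.tendsto_sum_nat.add hboundary
  have hsummable : Summable fun n => (f (n + 1) - f n) * ∑' y, q (n + 1 + y) := by
    rw [← summable_nat_add_iff M]
    refine ((hasSum_iff_tendsto_nat_of_nonneg (fun n => ?_) (∑' n, f n * q n -
      ∑ n ∈ Finset.range M, (f (n + 1) - f n) * ∑' y, q (n + 1 + y))).2 ?_).summable
    · exact mul_nonneg (sub_nonneg.2 (hmono _ _ (by omega) (by omega)))
        (tsum_nonneg fun y => hq0 _)
    · refine (((tendsto_add_atTop_iff_nat M).2 hlim).sub_const _).congr fun N => ?_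
      rw [add_comm N M, Finset.sum_range_add, add_sub_cancel_left]
      simp only [add_comm M]
  exact (tendsto_nhds_unique hsummable.hasSum.tendsto_sum_nat hlim) ▸ hsummable.hasSum

theorem mul_le_of_mul_abs_le {lam x : ℝ} {k i : ℕ} (hi : i < k) (hx : k * |lam| ≤ x) :
    (i : ℝ) * lam ≤ x :=
  calc (i : ℝ) * lam ≤ i * |lam| := by gcongr; exact le_abs_self lam
    _ ≤ k * |lam| := by gcongr
    _ ≤ x := hx

theorem dfact_nonneg {lam x : ℝ} {k : ℕ} (hx : k * |lam| ≤ x) : 0 ≤ dfact lam x k :=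
  Finset.prod_nonneg fun _ hi =>
    sub_nonneg.2 (mul_le_of_mul_abs_le (Finset.mem_range.1 hi) hx)

theorem dfact_le_dfact {lam x y : ℝ} {k : ℕ} (hx : k * |lam| ≤ x) (hxy : x ≤ y) :
    dfact lam x k ≤ dfact lam y k :=
  Finset.prod_le_prod
    (fun _ hi => sub_nonneg.2 (mul_le_of_mul_abs_le (Finset.mem_range.1 hi) hx))
    fun _ _ => sub_le_sub_right hxy _

theorem dfact_zero_left (lam : ℝ) {k : ℕ} (hk : 0 < k) : dfact lam 0 k = 0 :=
  Finset.prod_eq_zero (Finset.mem_range.2 hk) (by simp)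

theorem stmt_2 (lam : ℝ) (k : ℕ) (hk : 0 < k) (p : ℕ → NNReal)
    (hp : ∑' x : ℕ, p x = 1)
    (hsum : Summable (fun x : ℕ => |dfact lam x k| * (p x : ℝ))) :
    ∑' x : ℕ, dfact lam x k * (p x : ℝ) =
      ∑' x : ℕ, (dfact lam (x + 1) k - dfact lam x k) * (∑' y : ℕ, (p (x + 1 + y) : ℝ)) := by
  have hps : Summable p := by
    by_contra h
    simp [tsum_eq_zero_of_not_summable h] at hp
  have hfp : Summable fun x : ℕ => dfact lam x k * (p x : ℝ) := by
    refine Summable.of_abs ?_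
    simpa only [abs_mul, NNReal.abs_eq] using hsum
  have hM {n : ℕ} (hn : ⌈k * |lam|⌉₊ ≤ n) : k * |lam| ≤ n := Nat.ceil_le.1 hn
  have h := hasSum_sub_mul_tsum_tail (f := fun n : ℕ => dfact lam n k) (q := fun n => (p n : ℝ))
    (by simpa using dfact_zero_left lam hk) (fun n hn => dfact_nonneg (hM hn))
    (fun m n hm hmn => dfact_le_dfact (hM hm) (Nat.cast_le.2 hmn))
    (fun n => (p n).coe_nonneg) (NNReal.summable_coe.2 hps) hfp
  simpa only [Nat.cast_add, Nat.cast_one] using h.tsum_eq.symm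
end

section
/- Let λ be a real number and let β : ℕ → ℝ be the sequence of degenerate Bernoulli numbers, i.e., the unique sequence with β(0) = 1 satisfying, for every integer n ≥ 1, Σ_{l=0}^{n−1} C(n, l) · (1)_{n−l,λ} · β(l) = (1 if n = 1, and 0 if n ≥ 2). Then for all positive integers m and n, Σ_{k=0}^{n−1} (k)_{m,λ} = (1/(m+1)) · Σ_{l=0}^{m} C(m+1, l) · (n)_{m+1−l,λ} · β(l); that is, S_{m,λ}(n−1) = (1/(m+1)) · Σ_{l=0}^{m} C(m+1, l) · (n)_{m+1−l,λ} · β(l). -/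
/-- The exponential generating function of a real sequence. -/
noncomputable def egf (a : ℕ → ℝ) : PowerSeries ℝ := PowerSeries.mk fun n => a n / n.factorial

theorem coeff_egf_mul (a b : ℕ → ℝ) (n : ℕ) :
    PowerSeries.coeff n (egf a * egf b) =
      (∑ p ∈ Finset.HasAntidiagonal.antidiagonal n,
        (n.choose p.1 : ℝ) * (a p.1 * b p.2)) / n.factorial := by
  rw [PowerSeries.coeff_mul, Finset.sum_div]
  refine Finset.sum_congr rfl fun p hp => ?_
  have hpn : p.1 + p.2 = n := Finset.HasAntidiagonal.mem_antidiagonal.mp hp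
  rw [← hpn, Nat.cast_add_choose]
  have := Nat.factorial_ne_zero (p.1 + p.2)
  simp only [egf, PowerSeries.coeff_mk]
  field_simp

theorem egf_dfact_add (lam x y : ℝ) :
    egf (dfact lam (x + y)) = egf (dfact lam x) * egf (dfact lam y) := by
  ext n
  rw [coeff_egf_mul, ← dfact_add]
  simp [egf]

theorem egf_dfact_zero (lam : ℝ) : egf (dfact lam 0) = 1 := by
  ext n
  cases n with
  | zero => simp [egf, dfact]
  | succ n => simp [egf, dfact, Finset.prod_range_succ', PowerSeries.coeff_one]

theorem egf_dfact_natCast_sub_one (lam : ℝ) (n : ℕ) :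
    egf (dfact lam n) - 1 =
      (egf (dfact lam 1) - 1) * ∑ k ∈ Finset.range n, egf (dfact lam k) := by
  induction n with
  | zero => simp [egf_dfact_zero]
  | succ n ih =>
    rw [Finset.sum_range_succ, mul_add, ← ih, Nat.cast_succ, egf_dfact_add]
    ring

theorem coeff_egf_mul_egf_dfact_sub_one (lam x : ℝ) (β : ℕ → ℝ) (n : ℕ) :
    PowerSeries.coeff n (egf β * (egf (dfact lam x) - 1)) =
      (∑ l ∈ Finset.range n, (n.choose l : ℝ) * dfact lam x (n - l) * β l) / n.factorial := by
  rw [mul_sub, mul_one, map_sub, coeff_egf_mul,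
    Finset.Nat.sum_antidiagonal_eq_sum_range_succ
      (fun i j => (n.choose i : ℝ) * (β i * dfact lam x j)), Finset.sum_range_succ]
  simp only [egf, PowerSeries.coeff_mk, Nat.choose_self, Nat.sub_self, dfact_zero, Nat.cast_one,
    one_mul, mul_one, add_div, add_sub_cancel_right]
  congr 1
  exact Finset.sum_congr rfl fun l _ => by ring

theorem stmt_4 (lam : ℝ) (β : ℕ → ℝ) (hβ0 : β 0 = 1)
    (hβ : ∀ n : ℕ, 1 ≤ n →
      ∑ l ∈ Finset.range n, (n.choose l : ℝ) * dfact lam 1 (n - l) * β l =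
        if n = 1 then 1 else 0)
    (m n : ℕ) (hm : 0 < m) (hn : 0 < n) :
    ∑ k ∈ Finset.range n, dfact lam k m =
      (1 / (m + 1)) * ∑ l ∈ Finset.range (m + 1),
        ((m + 1).choose l : ℝ) * dfact lam n (m + 1 - l) * β l := by
  have hB : egf β * (egf (dfact lam 1) - 1) = PowerSeries.X := by
    ext k
    rw [coeff_egf_mul_egf_dfact_sub_one, PowerSeries.coeff_X]
    rcases Nat.eq_zero_or_pos k with rfl | hk
    · simp
    · rw [hβ k hk]
      split_ifs with h <;> simp [h]
  have h := coeff_egf_mul_egf_dfact_sub_one lam n β (m + 1)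
  rw [egf_dfact_natCast_sub_one, ← mul_assoc, hB, PowerSeries.coeff_succ_X_mul, map_sum] at h
  simp only [egf, PowerSeries.coeff_mk] at h
  rw [← Finset.sum_div, Nat.factorial_succ, Nat.cast_mul, Nat.cast_succ] at h
  have hm0 : (m.factorial : ℝ) ≠ 0 := Nat.cast_ne_zero.mpr m.factorial_ne_zero
  have hm1 : (m : ℝ) + 1 ≠ 0 := Nat.cast_add_one_ne_zero m
  field_simp at h ⊢
  linarith
end

section
/- Let λ be a real number and let St : ℕ × ℕ → ℝ be the degenerate Stirling numbers of the second kind, i.e., the unique array such that for every integer n ≥ 0 and every real number x, (x)_{n,λ} = Σ_{k=0}^{n} St(n, k) · (x)_k, where (x)_k = x(x−1)⋯(x−k+1) is the ordinary falling factorial. Then for every positive integer k and every positive integer n, S_{k,λ}(n) = Σ_{l=1}^{k} St(k, l) · C(n+1, l+1) · l!. -/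
theorem prod_range_natCast_sub_eq_factorial_mul_choose (m l : ℕ) :
    ∏ i ∈ Finset.range l, ((m : ℝ) - i) = l.factorial * m.choose l := by
  rw [← descPochhammer_eval_eq_prod_range, descPochhammer_eval_eq_descFactorial,
    Nat.descFactorial_eq_factorial_mul_choose, Nat.cast_mul]

theorem sum_Icc_one_choose (n l : ℕ) (hl : 0 < l) :
    ∑ j ∈ Finset.Icc 1 n, j.choose l = (n + 1).choose (l + 1) := by
  rw [← Nat.sum_Icc_choose]
  refine (Finset.sum_subset (Finset.Icc_subset_Icc_left hl) fun j hj hj' => ?_).symm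
  simp only [Finset.mem_Icc] at hj hj'
  exact Nat.choose_eq_zero_of_lt (by omega)

theorem dfact_zero_left_s5 (lam : ℝ) {n : ℕ} (hn : 0 < n) : dfact lam 0 n = 0 :=
  Finset.prod_eq_zero (Finset.mem_range.2 hn) (by simp)

theorem stmt_5 (lam : ℝ) (St : ℕ → ℕ → ℝ)
    (hSt : ∀ (n : ℕ) (x : ℝ),
      dfact lam x n = ∑ k ∈ Finset.range (n + 1), St n k * ∏ i ∈ Finset.range k, (x - i))
    (k n : ℕ) (hk : 0 < k) (hn : 0 < n) :
    Sdeg lam k n =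
      ∑ l ∈ Finset.Icc 1 k, St k l * ((n + 1).choose (l + 1) : ℝ) * (l.factorial : ℝ) := by
  have hSt0 : St k 0 = 0 := by
    have h := hSt k 0
    rw [dfact_zero_left_s5 lam hk, Finset.sum_range_succ', Finset.sum_eq_zero] at h
    · simpa using h.symm
    · intro l _
      rw [Finset.prod_eq_zero (Finset.mem_range.2 l.succ_pos) (by simp), mul_zero]
  have hdfact (j : ℕ) :
      dfact lam j k = ∑ l ∈ Finset.Icc 1 k, St k l * (l.factorial * j.choose l) := by
    simp_rw [hSt k j, prod_range_natCast_sub_eq_factorial_mul_choose]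
    rw [Finset.range_eq_Ico, Finset.sum_eq_sum_Ico_succ_bot k.succ_pos, hSt0, zero_mul, zero_add]
    rfl
  simp_rw [Sdeg, hdfact]
  rw [Finset.sum_comm]
  refine Finset.sum_congr rfl fun l hl => ?_
  rw [← Finset.mul_sum, ← Finset.mul_sum, ← Nat.cast_sum,
    sum_Icc_one_choose n l (Finset.mem_Icc.1 hl).1]
  ring
end

section
/- Let λ be a real number and let β : ℕ → ℝ be the degenerate Bernoulli numbers, i.e., the unique sequence with β(0) = 1 satisfying, for every integer n ≥ 1, Σ_{l=0}^{n−1} C(n, l) · (1)_{n−l,λ} · β(l) = (1 if n = 1, and 0 if n ≥ 2). Define the degenerate Bernoulli polynomials by β_{m,λ}(x) = Σ_{j=0}^{m} C(m, j) · β(j) · (x)_{m−j,λ}. Then for every real number x, every nonnegative integer m and every positive integer n, Σ_{k=0}^{n−1} (k+x)_{m,λ} = (1/(m+1)) · (β_{m+1,λ}(n+x) − β_{m+1,λ}(x)) = (1/(m+1)) · Σ_{l=0}^{m} C(m+1, l) · β_{l,λ}(x) · (n)_{m+1−l,λ}. -/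
/-- The degenerate Bernoulli polynomial built from a sequence of numbers `β`. -/
def dBernPoly (lam : ℝ) (β : ℕ → ℝ) (m : ℕ) (x : ℝ) : ℝ :=
  ∑ j ∈ Finset.range (m + 1), (m.choose j : ℝ) * β j * dfact lam x (m - j)

/-- The degenerate exponential series `e_λ^x(t) = ∑ (x)_{n,λ} tⁿ / n!`. -/
noncomputable def dexp (lam x : ℝ) : PowerSeries ℝ :=
  PowerSeries.mk fun n => dfact lam x n / (n.factorial : ℝ)

open PowerSeries in
theorem coeff_dexp (lam x : ℝ) (n : ℕ) :
    coeff n (dexp lam x) = dfact lam x n / (n.factorial : ℝ) := by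
  simp [dexp]

open PowerSeries in
theorem coeff_one_add_mul_X_mul_derivative (lam : ℝ) (f : PowerSeries ℝ) (n : ℕ) :
    coeff n ((1 + C lam * X) * derivative ℝ f) =
      coeff (n + 1) f * (n + 1) + lam * (n * coeff n f) := by
  have hs : coeff n (X * derivative ℝ f) = n * coeff n f := by
    cases n with
    | zero => simp
    | succ k => rw [coeff_succ_X_mul, coeff_derivative]; push_cast; ring
  rw [add_mul, one_mul, map_add, mul_assoc, coeff_C_mul, coeff_derivative, hs]

open PowerSeries in
theorem dexp_ode (lam x : ℝ) :
    (1 + C lam * X) * derivative ℝ (dexp lam x) = C x * dexp lam x := by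
  ext n
  have hf : (n.factorial : ℝ) ≠ 0 := by positivity
  rw [coeff_one_add_mul_X_mul_derivative, coeff_C_mul, coeff_dexp, coeff_dexp,
    Nat.factorial_succ, dfact, Finset.prod_range_succ, ← dfact]
  push_cast
  field_simp
  ring

open PowerSeries in
theorem eq_dexp_of_ode (lam x : ℝ) (f : PowerSeries ℝ) (h0 : coeff 0 f = 1)
    (hf : (1 + C lam * X) * derivative ℝ f = C x * f) : f = dexp lam x := by
  ext n
  induction n with
  | zero => simp [h0, coeff_dexp, dfact]
  | succ n ih =>
    have key : ∀ g : PowerSeries ℝ, (1 + C lam * X) * derivative ℝ g = C x * g →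
        coeff (n + 1) g = (x - lam * n) * coeff n g / (n + 1) := by
      intro g hg
      have h := congrArg (coeff n) hg
      rw [coeff_one_add_mul_X_mul_derivative, coeff_C_mul] at h
      have hn : (n : ℝ) + 1 ≠ 0 := by positivity
      rw [eq_div_iff hn]
      linarith
    rw [key f hf, key _ (dexp_ode lam x), ih]

open PowerSeries in
theorem dexp_add (lam x y : ℝ) : dexp lam (x + y) = dexp lam x * dexp lam y := by
  refine (eq_dexp_of_ode lam (x + y) _ ?_ ?_).symm
  · simp [coeff_mul, coeff_dexp, dfact]
  · rw [Derivation.leibniz, smul_eq_mul, smul_eq_mul, map_add]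
    linear_combination dexp lam x * dexp_ode lam y + dexp lam y * dexp_ode lam x

theorem dexp_zero (lam : ℝ) : dexp lam 0 = 1 := by
  ext n
  cases n with
  | zero => simp [coeff_dexp, dfact]
  | succ n => simp [coeff_dexp, dfact, Finset.prod_range_succ', PowerSeries.coeff_one]

/-- The coefficients of a product of exponential generating functions are binomial convolutions. -/
theorem coeff_mul_egf (a b : ℕ → ℝ) (n : ℕ) :
    PowerSeries.coeff n (PowerSeries.mk (fun k => a k / (k.factorial : ℝ)) *
      PowerSeries.mk fun k => b k / (k.factorial : ℝ)) =
      (∑ l ∈ Finset.range (n + 1), (n.choose l : ℝ) * a l * b (n - l)) / (n.factorial : ℝ) := by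
  rw [PowerSeries.coeff_mul, Finset.Nat.sum_antidiagonal_eq_sum_range_succ_mk, Finset.sum_div]
  refine Finset.sum_congr rfl fun l hl => ?_
  have hl : l ≤ n := Nat.lt_succ_iff.mp (Finset.mem_range.mp hl)
  have h1 : (n.factorial : ℝ) ≠ 0 := by positivity
  have h2 : (l.factorial : ℝ) ≠ 0 := by positivity
  have h3 : ((n - l).factorial : ℝ) ≠ 0 := by positivity
  rw [Nat.cast_choose ℝ hl, PowerSeries.coeff_mk, PowerSeries.coeff_mk]
  field_simp

theorem mk_dBernPoly (lam : ℝ) (β : ℕ → ℝ) (x : ℝ) :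
    PowerSeries.mk (fun k => dBernPoly lam β k x / (k.factorial : ℝ)) =
      PowerSeries.mk (fun k => β k / (k.factorial : ℝ)) * dexp lam x := by
  ext n
  rw [dexp, coeff_mul_egf, PowerSeries.coeff_mk, dBernPoly]

theorem mk_mul_dexp_one_sub_one (lam : ℝ) (β : ℕ → ℝ)
    (hβ : ∀ n : ℕ, 1 ≤ n →
      ∑ l ∈ Finset.range n, (n.choose l : ℝ) * dfact lam 1 (n - l) * β l =
        if n = 1 then 1 else 0) :
    PowerSeries.mk (fun k => β k / (k.factorial : ℝ)) * (dexp lam 1 - 1) = PowerSeries.X := by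
  ext n
  rw [mul_sub, mul_one, map_sub, dexp, coeff_mul_egf, PowerSeries.coeff_mk, ← sub_div,
    Finset.sum_range_succ, PowerSeries.coeff_X]
  simp only [Nat.choose_self, Nat.sub_self, dfact, Finset.prod_range_zero, Nat.cast_one, one_mul,
    mul_one, add_sub_cancel_right]
  rcases Nat.eq_zero_or_pos n with rfl | hn
  · simp
  · have h := hβ n hn
    simp only [dfact] at h
    simp only [mul_right_comm _ (β _), h]
    split_ifs with h1
    · simp [h1]
    · simp

theorem sum_dexp_mul (lam : ℝ) (n : ℕ) :
    (∑ k ∈ Finset.range n, dexp lam k) * (dexp lam 1 - 1) = dexp lam n - 1 := by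
  induction n with
  | zero => simp [dexp_zero]
  | succ n ih =>
    rw [Finset.sum_range_succ, add_mul, ih, Nat.cast_succ, dexp_add]
    ring

theorem stmt_6 (lam : ℝ) (β : ℕ → ℝ) (hβ0 : β 0 = 1)
    (hβ : ∀ n : ℕ, 1 ≤ n →
      ∑ l ∈ Finset.range n, (n.choose l : ℝ) * dfact lam 1 (n - l) * β l =
        if n = 1 then 1 else 0)
    (x : ℝ) (m n : ℕ) (hn : 0 < n) :
    (∑ k ∈ Finset.range n, dfact lam (k + x) m =
        (1 / (m + 1)) * (dBernPoly lam β (m + 1) (n + x) - dBernPoly lam β (m + 1) x)) ∧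
      ∑ k ∈ Finset.range n, dfact lam (k + x) m =
        (1 / (m + 1)) * ∑ l ∈ Finset.range (m + 1),
          ((m + 1).choose l : ℝ) * dBernPoly lam β l x * dfact lam n (m + 1 - l) := by
  have hf : ((m + 1).factorial : ℝ) ≠ 0 := by positivity
  have hf' : (m.factorial : ℝ) ≠ 0 := by positivity
  have hm : (m : ℝ) + 1 ≠ 0 := by positivity
  set B := PowerSeries.mk (fun k => β k / (k.factorial : ℝ)) with hB
  have hsum : B * dexp lam (n + x) - B * dexp lam x =
      PowerSeries.X * ∑ k ∈ Finset.range n, dexp lam (k + x) := by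
    rw [← mk_mul_dexp_one_sub_one lam β hβ]
    simp only [dexp_add, ← Finset.sum_mul]
    linear_combination (-(B * dexp lam x)) * sum_dexp_mul lam n
  have hfirst : ∑ k ∈ Finset.range n, dfact lam (k + x) m =
      (1 / (m + 1)) * (dBernPoly lam β (m + 1) (n + x) - dBernPoly lam β (m + 1) x) := by
    have h := congrArg (PowerSeries.coeff (m + 1)) hsum
    rw [hB, ← mk_dBernPoly, ← mk_dBernPoly, map_sub, PowerSeries.coeff_mk, PowerSeries.coeff_mk,
      PowerSeries.coeff_succ_X_mul, map_sum] at h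
    simp only [coeff_dexp, ← Finset.sum_div] at h
    rw [Nat.factorial_succ] at h
    push_cast at h
    field_simp at h ⊢
    linarith
  refine ⟨hfirst, hfirst.trans ?_⟩
  have hshift : PowerSeries.mk (fun k => dBernPoly lam β k (n + x) / (k.factorial : ℝ)) =
      PowerSeries.mk (fun k => dBernPoly lam β k x / (k.factorial : ℝ)) * dexp lam n := by
    rw [mk_dBernPoly, mk_dBernPoly, dexp_add]
    ring
  have h := congrArg (PowerSeries.coeff (m + 1)) hshift
  rw [dexp, coeff_mul_egf, PowerSeries.coeff_mk, div_left_inj' hf, Finset.sum_range_succ] at h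
  rw [h]
  simp [dfact]
end

section
/- For every real number λ, all real numbers x and y, and every nonnegative integer n, the degenerate falling factorials satisfy the addition formula (x+y)_{n,λ} = Σ_{k=0}^{n} C(n, k) · (x)_{k,λ} · (y)_{n−k,λ}. -/
theorem dfact_add_eq_sum_antidiagonal (lam x y : ℝ) (n : ℕ) :
    dfact lam (x + y) n = ∑ ij ∈ Finset.HasAntidiagonal.antidiagonal n,
      (n.choose ij.1 : ℝ) * (dfact lam x ij.1 * dfact lam y ij.2) := by
  induction n with
  | zero => simp [dfact]
  | succ n ih =>
    rw [Finset.sum_antidiagonal_choose_succ_mul fun i j => dfact lam x i * dfact lam y j,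
      ← Finset.sum_add_distrib, dfact_succ, ih, Finset.sum_mul]
    refine Finset.sum_congr rfl fun ⟨i, j⟩ hij => ?_
    obtain rfl : i + j = n := Finset.HasAntidiagonal.mem_antidiagonal.1 hij
    simp only [dfact_succ, Nat.choose_symm_add (a := i) (b := j), Nat.cast_add]
    ring

theorem stmt_7 (lam x y : ℝ) (n : ℕ) :
    dfact lam (x + y) n =
      ∑ k ∈ Finset.range (n + 1), (n.choose k : ℝ) * dfact lam x k * dfact lam y (n - k) := by
  rw [dfact_add_eq_sum_antidiagonal, Finset.Nat.sum_antidiagonal_eq_sum_range_succ_mk]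
  simp only [mul_assoc]
end

section
/- For every real number λ, every positive integer k and every real number j, (j)_{k+1,λ} − (j−1)_{k+1,λ} = (k+1)·(j)_{k,λ} − Σ_{r=0}^{k−1} C(k+1, r) · (−1)^{k+1−r} · ⟨1⟩_{k+1−r,λ} · (j)_{r,λ}. -/
theorem stmt_9 (lam : ℝ) (k : ℕ) (hk : 0 < k) (j : ℝ) :
    dfact lam j (k + 1) - dfact lam (j - 1) (k + 1) =
      (k + 1) * dfact lam j k -
        ∑ r ∈ Finset.range k,
          ((k + 1).choose r : ℝ) * (-1) ^ (k + 1 - r) * drise lam 1 (k + 1 - r) *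
            dfact lam j r := by
  have hexpand : dfact lam (j - 1) (k + 1) =
      ∑ r ∈ Finset.range (k + 2),
        ((k + 1).choose r : ℝ) * (-1) ^ (k + 1 - r) * drise lam 1 (k + 1 - r) *
          dfact lam j r := by
    rw [sub_eq_add_neg, dfact_add, Finset.Nat.sum_antidiagonal_eq_sum_range_succ_mk]
    refine Finset.sum_congr rfl fun r _ => ?_
    rw [dfact_neg]
    ring
  rw [hexpand, Finset.sum_range_succ, Finset.sum_range_succ]
  simp [drise]
  ring
end
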